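/- arXiv:1911.04132 — 3 statements merged into one kernel-verified Lean document; each statement's English description precedes it below -/
import Mathlib

section
/- Let n ≥ 1 and let λ₁ ≥ λ₂ ≥ ⋯ ≥ λₙ be real numbers. A tuple of real numbers (u_{i,k})_{1 ≤ i ≤ k ≤ n−1} arises as (μ_i(x^{(k)}))_{1 ≤ i ≤ k ≤ n−1} for some n×n complex Hermitian matrix x whose characteristic polynomial equals ∏_{i=1}^{n}(X − λ_i) if and only if, setting u_{i,n} := λ_i for 1 ≤ i ≤ n, the Gelfand–Cetlin inequalities u_{i,k+1} ≥ u_{i,k} ≥ u_{i+1,k+1} hold for all 1 ≤ i ≤ k ≤ n−1. In other words, the image of the Gelfand–Cetlin map on the set of Hermitian matrices with eigenvalues λ₁, …, λₙ (with multiplicity) is exactly the Gelfand–Cetlin polytope Δ_λ. -/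
open Polynomial
open scoped Matrix

/-- Two families over a finite type with the same multiset of values differ by a permutation. -/
theorem exists_perm_comp_eq_of_map_univ_eq {ι α : Type*} [Fintype ι] {f g : ι → α}
    (h : Finset.univ.val.map f = Finset.univ.val.map g) :
    ∃ σ : Equiv.Perm ι, g ∘ σ = f := by
  classical
  have hcard (c : α) : Fintype.card {i // f i = c} = Fintype.card {i // g i = c} := by
    have := congrArg (Multiset.count c) h
    rw [Multiset.count_map, Multiset.count_map] at this
    simp only [Fintype.card_subtype, Finset.card_def, Finset.filter_val]
    simpa only [eq_comm] using this
  exact ⟨Equiv.ofFiberEquiv fun c => Fintype.equivOfCardEq (hcard c),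
    funext fun i => Equiv.ofFiberEquiv_map _ i⟩

/-- A Hermitian matrix with characteristic polynomial `∏ (X - bᵢ)` is unitarily similar to
`diagonal b`. -/
theorem Matrix.IsHermitian.exists_unitary_eq_of_charpoly_eq {ι : Type*} [Fintype ι] [DecidableEq ι]
    {A : Matrix ι ι ℂ} (hA : A.IsHermitian) {b : ι → ℝ}
    (h : A.charpoly = ∏ i, (X - C (b i : ℂ))) :
    ∃ U ∈ Matrix.unitaryGroup ι ℂ, A = U * Matrix.diagonal (fun i => (b i : ℂ)) * star U := by
  obtain ⟨σ, hσ⟩ : ∃ σ : Equiv.Perm ι, b ∘ σ = hA.eigenvalues := by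
    refine exists_perm_comp_eq_of_map_univ_eq
      (Multiset.map_injective Complex.ofReal_injective ?_)
    have h1 := hA.roots_charpoly_eq_eigenvalues
    have h2 : A.charpoly.roots = Finset.univ.val.map fun i => (b i : ℂ) := by
      rw [h, ← roots_multiset_prod_X_sub_C (Finset.univ.val.map fun i => (b i : ℂ)),
        Multiset.map_map]
      rfl
    rw [Multiset.map_map, Multiset.map_map]
    exact h1.symm.trans h2
  let V : Matrix ι ι ℂ := hA.eigenvectorUnitary
  have hV : V * star V = 1 := Unitary.coe_mul_star_self _
  refine ⟨V.submatrix id σ.symm, ?_, ?_⟩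
  · rw [Matrix.mem_unitaryGroup_iff, Matrix.star_eq_conjTranspose, Matrix.conjTranspose_submatrix,
      Matrix.submatrix_mul_equiv]
    simpa [Matrix.star_eq_conjTranspose] using hV
  · have hd : Matrix.diagonal (fun i => (b i : ℂ)) =
        (Matrix.diagonal (fun i => (hA.eigenvalues i : ℂ))).submatrix σ.symm σ.symm := by
      rw [Matrix.submatrix_diagonal_equiv, ← hσ]
      simp [Function.comp_def]
    rw [hd, Matrix.star_eq_conjTranspose, Matrix.conjTranspose_submatrix,
      Matrix.submatrix_mul_equiv, Matrix.submatrix_mul_equiv, Matrix.submatrix_id_id]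
    have := hA.spectral_theorem
    rwa [Unitary.conjStarAlgAut_apply] at this

/-- Determinant of a bordered diagonal matrix. -/
theorem Matrix.det_fromBlocks_diagonal {ι R : Type*} [Fintype ι] [DecidableEq ι] [CommRing R]
    [IsDomain R] (d v w : ι → R) (x : R) (hd : ∀ i, d i ≠ 0) :
    (Matrix.fromBlocks (Matrix.diagonal d) (Matrix.replicateCol (Fin 1) v)
      (Matrix.replicateRow (Fin 1) w) (Matrix.of fun _ _ => x)).det =
    x * ∏ i, d i - ∑ i, w i * v i * ∏ j ∈ Finset.univ.erase i, d j := by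
  let K := FractionRing R
  let φ : R →+* K := algebraMap R K
  have hφ : Function.Injective φ := IsFractionRing.injective R K
  have hd' (i) : φ (d i) ≠ 0 := fun h => hd i (hφ (by simpa using h))
  apply hφ
  have hmap : φ.mapMatrix (Matrix.fromBlocks (Matrix.diagonal d) (Matrix.replicateCol (Fin 1) v)
      (Matrix.replicateRow (Fin 1) w) (Matrix.of fun _ _ => x)) =
      Matrix.fromBlocks (Matrix.diagonal (φ ∘ d)) (Matrix.replicateCol (Fin 1) (φ ∘ v))
      (Matrix.replicateRow (Fin 1) (φ ∘ w)) (Matrix.of fun _ _ => φ x) := by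
    ext (i | i) (j | j) <;> simp [Matrix.diagonal_apply, apply_ite φ]
  let _ : Invertible (φ ∘ d) :=
    ⟨fun i => (φ (d i))⁻¹, by ext i; exact inv_mul_cancel₀ (hd' i),
      by ext i; exact mul_inv_cancel₀ (hd' i)⟩
  let _ := Matrix.diagonalInvertible (φ ∘ d)
  rw [RingHom.map_det, hmap, Matrix.det_fromBlocks₁₁, Matrix.det_diagonal,
    Matrix.invOf_diagonal_eq, Matrix.det_fin_one]
  simp only [Matrix.sub_apply, Matrix.of_apply, Matrix.mul_apply, Matrix.replicateRow_apply,
    Matrix.replicateCol_apply, Function.comp_apply, map_sub, map_mul,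
    map_sum, map_prod, mul_sub]
  congr 1
  · ring
  · rw [Finset.mul_sum]
    refine Finset.sum_congr rfl fun i _ => ?_
    have hw : ∑ j, φ (w j) * Matrix.diagonal (⅟(φ ∘ d)) j i = φ (w i) * (φ (d i))⁻¹ := by
      rw [Finset.sum_eq_single_of_mem i (Finset.mem_univ i) fun j _ hji => by
        rw [Matrix.diagonal_apply_ne _ hji, mul_zero], Matrix.diagonal_apply_eq]
      rfl
    rw [← Finset.mul_prod_erase _ _ (Finset.mem_univ i), hw]
    linear_combination (φ (w i) * φ (v i) * ∏ j ∈ Finset.univ.erase i, φ (d j)) *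
      mul_inv_cancel₀ (hd' i)

/-- Characteristic polynomial of a bordered diagonal matrix. -/
theorem Matrix.charpoly_fromBlocks_diagonal {ι R : Type*} [Fintype ι] [DecidableEq ι] [CommRing R]
    [IsDomain R] (d v w : ι → R) (x : R) :
    (Matrix.fromBlocks (Matrix.diagonal d) (Matrix.replicateCol (Fin 1) v)
      (Matrix.replicateRow (Fin 1) w) (Matrix.of fun _ _ => x)).charpoly =
    (X - C x) * ∏ i, (X - C (d i)) -
      ∑ i, C (w i * v i) * ∏ j ∈ Finset.univ.erase i, (X - C (d j)) := by
  have := Matrix.det_fromBlocks_diagonal (fun i => X - C (d i)) (fun i => -C (v i))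
    (fun i => -C (w i)) (X - C x) fun i => X_sub_C_ne_zero _
  simp only [neg_mul_neg, ← C_mul] at this
  rw [← this, Matrix.charpoly, Matrix.charmatrix_fromBlocks]
  congr 1
  ext (i | i) (j | j) : 2
  · simp [Matrix.diagonal_apply]
  · simp
  · simp
  · simp [Subsingleton.elim i j]

/-- If `b` interlaces `a₀, a`, then `(X - a₀) ∏ (X - aᵢ)` divided by `∏ (X - bᵢ)` is of the form
`X - c - ∑ rᵢ / (X - bᵢ)` with all `rᵢ` nonnegative, stated after clearing denominators. -/
theorem exists_partial_fraction_of_interlacing {ι : Type*} [LinearOrder ι] (a₀ : ℝ) (a b : ι → ℝ)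
    (s : Finset ι) (h₀ : ∀ i ∈ s, b i ≤ a₀) (h₁ : ∀ i ∈ s, a i ≤ b i)
    (h₂ : ∀ i ∈ s, ∀ j ∈ s, i < j → b j ≤ a i) :
    ∃ (c : ℝ) (r : ι → ℝ), (∀ i, 0 ≤ r i) ∧
      (X - C a₀) * ∏ i ∈ s, (X - C (a i)) =
        (X - C c) * ∏ i ∈ s, (X - C (b i)) -
          ∑ i ∈ s, C (r i) * ∏ j ∈ s.erase i, (X - C (b j)) := by
  induction s using Finset.strongInduction with
  | H s ih =>
  by_cases hinj : Set.InjOn b s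
  · set f : ℝ[X] := (X - C a₀) * ∏ i ∈ s, (X - C (a i)) with hf
    set g : ℝ[X] := ∏ i ∈ s, (X - C (b i)) with hg
    have hgm : g.Monic := monic_prod_X_sub_C _ _
    have hfm : f.Monic := (monic_X_sub_C _).mul (monic_prod_X_sub_C _ _)
    have hgd : g.natDegree = s.card := natDegree_finsetProd_X_sub_C_eq_card _ _
    have hfd : f.natDegree = s.card + 1 := by
      rw [hf, (monic_X_sub_C _).natDegree_mul (monic_prod_X_sub_C _ _), natDegree_X_sub_C,
        natDegree_finsetProd_X_sub_C_eq_card, add_comm]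
    have hdeg : g.degree ≤ f.degree := by
      rw [degree_eq_natDegree hgm.ne_zero, degree_eq_natDegree hfm.ne_zero, hgd, hfd]
      exact_mod_cast Nat.le_succ _
    have hqm : (f /ₘ g).Monic := by
      rw [Monic, leadingCoeff_divByMonic_of_monic hgm hdeg, hfm.leadingCoeff]
    have hqd : (f /ₘ g).natDegree = 1 := by
      rw [natDegree_divByMonic _ hgm, hfd, hgd]; omega
    have hq : f /ₘ g = X - C (-(f /ₘ g).coeff 0) := by
      rw [C_neg, sub_neg_eq_add]
      exact hqm.eq_X_add_C hqd
    let r : ι → ℝ := fun i => (a₀ - b i) * (b i - a i) *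
      ∏ j ∈ s.erase i, ((b i - a j) / (b i - b j))
    have hr : ∀ i ∈ s, 0 ≤ r i := fun i hi => by
      refine mul_nonneg (mul_nonneg (sub_nonneg.2 (h₀ i hi)) (sub_nonneg.2 (h₁ i hi)))
        (Finset.prod_nonneg fun j hj => ?_)
      obtain ⟨hji, hj⟩ := Finset.mem_erase.1 hj
      rcases lt_or_gt_of_ne hji with hlt | hlt
      · have := h₂ j hj i hi hlt
        have := h₁ j hj
        exact div_nonneg_of_nonpos (by linarith) (by linarith)
      · have := h₂ i hi j hj hlt
        have := h₁ j hj
        have := h₁ i hi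
        exact div_nonneg (by linarith) (by linarith)
    refine ⟨-(f /ₘ g).coeff 0, fun i => max (r i) 0, fun i => le_max_right _ _, ?_⟩
    have hsum : ∑ i ∈ s, C (max (r i) 0) * ∏ j ∈ s.erase i, (X - C (b j)) =
        ∑ i ∈ s, C (r i) * ∏ j ∈ s.erase i, (X - C (b j)) :=
      Finset.sum_congr rfl fun i hi => by rw [max_eq_left (hr i hi)]
    rw [hsum, ← hq, eq_sub_iff_add_eq]
    have hrem : f %ₘ g = -∑ i ∈ s, C (r i) * ∏ j ∈ s.erase i, (X - C (b j)) := by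
      refine eq_of_degrees_lt_of_eval_index_eq s hinj ?_ ?_ fun i hi => ?_
      · have := degree_modByMonic_lt f hgm
        rwa [degree_eq_natDegree hgm.ne_zero, hgd] at this
      · rw [degree_neg]
        refine (degree_sum_le _ _).trans_lt ?_
        rw [Finset.sup_lt_iff (WithBot.bot_lt_coe _)]
        intro i hi
        rw [← smul_eq_C_mul]
        refine (degree_smul_le _ _).trans_lt ?_
        rw [degree_eq_natDegree (monic_prod_X_sub_C _ _).ne_zero,
          natDegree_finsetProd_X_sub_C_eq_card]
        exact_mod_cast Finset.card_erase_lt_of_mem hi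
      · have hgi : g.eval (b i) = 0 := by
          rw [hg, eval_prod]
          exact Finset.prod_eq_zero hi (by simp)
        have hfi : (f %ₘ g).eval (b i) = f.eval (b i) := by
          conv_rhs => rw [← modByMonic_add_div f g]
          simp [hgi]
        rw [hfi, eval_neg, eval_finsetSum, Finset.sum_eq_single_of_mem i hi]
        · rw [hf, eval_mul, eval_mul, eval_prod, eval_prod,
            ← Finset.mul_prod_erase _ _ hi]
          simp only [eval_sub, eval_X, eval_C, r]
          rw [mul_assoc, ← Finset.prod_mul_distrib]
          have : ∏ j ∈ s.erase i, ((b i - a j) / (b i - b j) * (b i - b j)) =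
              ∏ j ∈ s.erase i, (b i - a j) := Finset.prod_congr rfl fun j hj => by
            obtain ⟨hji, hj⟩ := Finset.mem_erase.1 hj
            exact div_mul_cancel₀ _ (sub_ne_zero.2 fun h => hji (hinj hj hi h.symm))
          rw [this]
          ring
        · intro j hj hji
          rw [eval_mul, eval_prod, Finset.prod_eq_zero (Finset.mem_erase.2 ⟨hji.symm, hi⟩) (by simp),
            mul_zero]
    linear_combination hrem - modByMonic_add_div f g
  · obtain ⟨i, hi, j, hj, hij, hlt⟩ : ∃ i ∈ s, ∃ j ∈ s, b i = b j ∧ i < j := by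
      simp only [Set.InjOn, not_forall] at hinj
      obtain ⟨i, hi, j, hj, hij, hne⟩ := hinj
      rcases lt_or_gt_of_ne hne with h | h
      exacts [⟨i, hi, j, hj, hij, h⟩, ⟨j, hj, i, hi, hij.symm, h⟩]
    have hab : a i = b i := le_antisymm (h₁ i hi) (hij ▸ h₂ i hi j hj hlt)
    obtain ⟨c, r, hr, h⟩ := ih (s.erase i) (Finset.erase_ssubset hi)
      (fun k hk => h₀ k (Finset.mem_of_mem_erase hk))
      (fun k hk => h₁ k (Finset.mem_of_mem_erase hk))
      (fun k hk l hl => h₂ k (Finset.mem_of_mem_erase hk) l (Finset.mem_of_mem_erase hl))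
    refine ⟨c, Function.update r i 0, fun k => ?_, ?_⟩
    · rcases eq_or_ne k i with rfl | hk
      · simp
      · simpa [hk] using hr k
    · rw [← Finset.mul_prod_erase _ _ hi, ← Finset.mul_prod_erase _ _ hi,
        ← Finset.add_sum_erase _ _ hi, mul_left_comm, h, hab]
      have : ∑ k ∈ s.erase i, C (Function.update r i 0 k) * ∏ l ∈ s.erase k, (X - C (b l)) =
          (X - C (b i)) *
            ∑ k ∈ s.erase i, C (r k) * ∏ l ∈ (s.erase i).erase k, (X - C (b l)) := by
        rw [Finset.mul_sum]
        refine Finset.sum_congr rfl fun k hk => ?_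
        obtain ⟨hki, hk⟩ := Finset.mem_erase.1 hk
        rw [Function.update_of_ne hki, Finset.erase_right_comm,
          ← Finset.mul_prod_erase _ _ (Finset.mem_erase.2 ⟨hki.symm, hi⟩)]
        ring
      rw [this]
      simp only [Function.update_self, C_0]
      ring

/-- A Hermitian matrix with spectrum `b` extends, by one row and one column, to a Hermitian matrix
with any prescribed spectrum `a₀, a` interlaced by `b`. -/
theorem Matrix.IsHermitian.exists_extension_of_interlacing {ι : Type*} [Fintype ι] [LinearOrder ι]
    {B : Matrix ι ι ℂ} (hB : B.IsHermitian) (a₀ : ℝ) (a b : ι → ℝ)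
    (hBb : B.charpoly = ∏ i, (X - C (b i : ℂ))) (h₀ : ∀ i, b i ≤ a₀) (h₁ : ∀ i, a i ≤ b i)
    (h₂ : ∀ i j, i < j → b j ≤ a i) :
    ∃ A : Matrix (ι ⊕ Fin 1) (ι ⊕ Fin 1) ℂ, A.IsHermitian ∧ A.submatrix Sum.inl Sum.inl = B ∧
      A.charpoly = (X - C (a₀ : ℂ)) * ∏ i, (X - C (a i : ℂ)) := by
  obtain ⟨c, r, hr, hcr⟩ := exists_partial_fraction_of_interlacing a₀ a b Finset.univ
    (fun i _ => h₀ i) (fun i _ => h₁ i) fun i _ j _ => h₂ i j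
  obtain ⟨U, hU, hUB⟩ := hB.exists_unitary_eq_of_charpoly_eq hBb
  let v : ι → ℂ := fun i => (√(r i) : ℝ)
  let M : Matrix (ι ⊕ Fin 1) (ι ⊕ Fin 1) ℂ :=
    Matrix.fromBlocks (Matrix.diagonal fun i => (b i : ℂ)) (Matrix.replicateCol (Fin 1) v)
      (Matrix.replicateRow (Fin 1) v) (Matrix.of fun _ _ => (c : ℂ))
  have hM : M.IsHermitian := by
    ext (i | i) (j | j)
    · rcases eq_or_ne i j with rfl | h
      · simp [M]
      · simp [M, h, h.symm]
    all_goals simp [M, v]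
  let W : Matrix (ι ⊕ Fin 1) (ι ⊕ Fin 1) ℂ := Matrix.fromBlocks U 0 0 1
  have hW : Wᴴ * W = 1 := by
    have : Uᴴ * U = 1 := Matrix.mem_unitaryGroup_iff'.1 hU
    simp [W, Matrix.fromBlocks_conjTranspose, Matrix.fromBlocks_multiply, this]
  refine ⟨W * M * Wᴴ, Matrix.isHermitian_mul_mul_conjTranspose W hM, ?_, ?_⟩
  · rw [hUB, Matrix.star_eq_conjTranspose]
    simp only [W, M, Matrix.fromBlocks_conjTranspose, Matrix.fromBlocks_multiply]
    ext i j
    simp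
  · rw [Matrix.charpoly_mul_comm, ← mul_assoc, hW, one_mul, Matrix.charpoly_fromBlocks_diagonal]
    have hv (i) : v i * v i = (r i : ℂ) := by
      rw [← Complex.ofReal_mul, Real.mul_self_sqrt (hr i)]
    have := congrArg (Polynomial.map Complex.ofRealHom) hcr
    simp only [Polynomial.map_mul, Polynomial.map_sub, map_X, map_C, Polynomial.map_prod,
      Polynomial.map_sum, Complex.ofRealHom_eq_coe] at this
    simp only [hv, this]

/-- Every Gelfand–Cetlin pattern with levels `1, …, n` is realised by the spectra of the
leading principal submatrices of a Hermitian matrix. -/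
theorem exists_isHermitian_of_gelfandCetlin (u : ℕ → ℕ → ℝ) (n : ℕ)
    (h : ∀ k i, 1 ≤ i → i ≤ k → k < n → u i k ≤ u i (k + 1) ∧ u (i + 1) (k + 1) ≤ u i k) :
    ∃ x : Matrix (Fin n) (Fin n) ℂ, x.IsHermitian ∧ ∀ k (hk : k ≤ n),
      (x.submatrix (Fin.castLE hk) (Fin.castLE hk)).charpoly =
        ∏ i : Fin k, (X - C (u (i + 1) k : ℂ)) := by
  induction n with
  | zero =>
    refine ⟨0, Matrix.isHermitian_zero, fun k hk => ?_⟩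
    obtain rfl : k = 0 := by omega
    simp [Matrix.charpoly]
  | succ n ih =>
    obtain ⟨y, hy, hyu⟩ := ih fun k i h1 h2 h3 => h k i h1 h2 (by omega)
    have hanti : ∀ i j, 1 ≤ i → i ≤ j → j ≤ n + 1 → u j (n + 1) ≤ u i (n + 1) := by
      intro i j hi hij
      induction j, hij using Nat.le_induction with
      | base => exact fun _ => le_rfl
      | succ j hij ihj =>
        intro hj
        have := h n j (by omega) (by omega) (by omega)
        exact (this.2.trans this.1).trans (ihj (by omega))
    obtain ⟨A, hA, hAy, hAu⟩ := hy.exists_extension_of_interlacing (u 1 (n + 1))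
      (fun i => u (i + 2) (n + 1)) (fun i => u (i + 1) n) (by simpa using hyu n le_rfl)
      (fun i => (h n (i + 1) (by omega) (by omega) (by omega)).1.trans
        (hanti _ _ le_rfl (by omega) (by omega)))
      (fun i => (h n (i + 1) (by omega) (by omega) (by omega)).2)
      (fun i j hij => (h n (j + 1) (by omega) (by omega) (by omega)).1.trans
        (hanti _ _ (by omega) (by have : (i : ℕ) < j := hij; omega) (by omega)))
    refine ⟨A.submatrix finSumFinEquiv.symm finSumFinEquiv.symm, hA.submatrix _, fun k hk => ?_⟩
    rcases hk.lt_or_eq with hk' | rfl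
    · rw [← hyu k (by omega), ← hAy, Matrix.submatrix_submatrix, Matrix.submatrix_submatrix]
      have hc : finSumFinEquiv.symm ∘ Fin.castLE hk =
          (Sum.inl : Fin n → Fin n ⊕ Fin 1) ∘ Fin.castLE (Nat.le_of_lt_succ hk') := by
        ext i : 1
        exact (Equiv.symm_apply_eq _).2 rfl
      rw [hc]
    · rw [Fin.prod_univ_succ]
      have : (A.submatrix finSumFinEquiv.symm finSumFinEquiv.symm).charpoly = A.charpoly :=
        Matrix.charpoly_reindex finSumFinEquiv A
      simpa [this, add_assoc] using hAu

/-- The Hermitian form of a real diagonal matrix. -/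
theorem Matrix.star_dotProduct_diagonal_mulVec {ι : Type*} [Fintype ι] [DecidableEq ι]
    (γ : ι → ℝ) (w : ι → ℂ) :
    star w ⬝ᵥ (Matrix.diagonal (fun i => (γ i : ℂ)) *ᵥ w) =
      ((∑ i, γ i * Complex.normSq (w i) : ℝ) : ℂ) := by
  simp only [dotProduct, Matrix.mulVec_diagonal, Complex.ofReal_sum, Complex.ofReal_mul,
    Complex.normSq_eq_conj_mul_self, Pi.star_apply, RCLike.star_def]
  exact Finset.sum_congr rfl fun i _ => by ring

/-- Real scalars pull out of the complexification of a real diagonal matrix. -/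
theorem Matrix.diagonal_ofReal_mul {ι : Type*} [DecidableEq ι] (ε : ℝ) (γ : ι → ℝ) :
    Matrix.diagonal (fun i => ((ε * γ i : ℝ) : ℂ)) =
      (ε : ℂ) • Matrix.diagonal fun i => (γ i : ℂ) := by
  rw [← Matrix.diagonal_smul]
  simp [Pi.smul_def]

/-- If a Hermitian form diagonalised by `α` restricts along an isometry `T` to one diagonalised
by `β`, then the quadratic forms agree. -/
theorem Matrix.sum_mul_normSq_mulVec {ι κ : Type*} [Fintype ι] [DecidableEq ι]
    [Fintype κ] [DecidableEq κ] {T : Matrix ι κ ℂ} {α : ι → ℝ} {β : κ → ℝ}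
    (h : Tᴴ * Matrix.diagonal (fun i => (α i : ℂ)) * T = Matrix.diagonal fun i => (β i : ℂ))
    (y : κ → ℂ) :
    ∑ i, α i * Complex.normSq ((T *ᵥ y) i) = ∑ j, β j * Complex.normSq (y j) := by
  apply Complex.ofReal_injective
  rw [← Matrix.star_dotProduct_diagonal_mulVec, ← Matrix.star_dotProduct_diagonal_mulVec, ← h,
    Matrix.star_mulVec, ← Matrix.dotProduct_mulVec, Matrix.mulVec_mulVec, Matrix.mulVec_mulVec,
    Matrix.mul_assoc]

/-- If a Hermitian form with eigenvalues `α` restricts along an isometry to one all of whose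
eigenvalues are at least `t`, then its dimension plus the number
of `α i` below `t` is at most the total dimension. -/
theorem Matrix.card_add_card_le_of_isometry {ι κ : Type*} [Fintype ι] [DecidableEq ι]
    [Fintype κ] [DecidableEq κ] {T : Matrix ι κ ℂ} {α : ι → ℝ} {β : κ → ℝ} (hT : Tᴴ * T = 1)
    (h : Tᴴ * Matrix.diagonal (fun i => (α i : ℂ)) * T = Matrix.diagonal fun i => (β i : ℂ))
    (t : ℝ) (P : Finset ι) (hP : ∀ p ∈ P, α p < t) (hβ : ∀ q, t ≤ β q) :
    P.card + Fintype.card κ ≤ Fintype.card ι := by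
  by_contra! hlt
  let L : (κ → ℂ) →ₗ[ℂ] ({i // i ∉ P} → ℂ) := (T.submatrix Subtype.val id).mulVecLin
  have hL : LinearMap.ker L ≠ ⊥ := L.ker_ne_bot_of_finrank_lt <| by
    rw [Module.finrank_fintype_fun_eq_card, Module.finrank_fintype_fun_eq_card,
      Fintype.card_subtype_compl, Fintype.card_coe]
    have := P.card_le_univ
    omega
  obtain ⟨y, hy, hy0⟩ := (Submodule.ne_bot_iff _).1 hL
  have hz (i) (hi : i ∉ P) : (T *ᵥ y) i = 0 := congrFun (LinearMap.mem_ker.1 hy) ⟨i, hi⟩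
  have hα := Matrix.sum_mul_normSq_mulVec h y
  have h1 := Matrix.sum_mul_normSq_mulVec (T := T) (α := fun _ => t) (β := fun _ => t)
    (by simp [← Matrix.smul_one_eq_diagonal, hT]) y
  have hnn : ∀ i ∈ Finset.univ, 0 ≤ (t - α i) * Complex.normSq ((T *ᵥ y) i) := fun i _ => by
    by_cases hi : i ∈ P
    · exact mul_nonneg (sub_nonneg.2 (hP i hi).le) (Complex.normSq_nonneg _)
    · simp [hz i hi]
  have hle : ∑ i, (t - α i) * Complex.normSq ((T *ᵥ y) i) ≤ 0 := by
    simp only [sub_mul, Finset.sum_sub_distrib]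
    rw [hα, h1, sub_nonpos]
    exact Finset.sum_le_sum fun j _ => mul_le_mul_of_nonneg_right (hβ j) (Complex.normSq_nonneg _)
  have hzero := (Finset.sum_eq_zero_iff_of_nonneg hnn).1 (hle.antisymm (Finset.sum_nonneg hnn))
  have hTy : T *ᵥ y = 0 := by
    ext i
    by_cases hi : i ∈ P
    · have := hzero i (Finset.mem_univ i)
      rcases mul_eq_zero.1 this with h' | h'
      · linarith [hP i hi]
      · exact Complex.normSq_eq_zero.1 h'
    · exact hz i hi
  apply hy0
  rw [← Matrix.one_mulVec y, ← hT, ← Matrix.mulVec_mulVec, hTy, Matrix.mulVec_zero]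

/-- **Cauchy interlacing**, in counting form: if a Hermitian matrix with spectrum `α` has a
principal submatrix with spectrum `β`, then the `α p` below `t` and the `β q` at least `t` are
together at most as many as all the `α p`. Taking `ε = -1` gives the statement with reversed
inequalities. -/
theorem Matrix.IsHermitian.card_add_card_le_of_submatrix {ι κ : Type*} [Fintype ι]
    [DecidableEq ι] [Fintype κ] [DecidableEq κ] {A : Matrix ι ι ℂ} {J : κ → ι}
    (hAh : A.IsHermitian) (hJ : Function.Injective J) {α : ι → ℝ} {β : κ → ℝ}
    (hA : A.charpoly = ∏ i, (X - C (α i : ℂ)))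
    (hB : (A.submatrix J J).charpoly = ∏ i, (X - C (β i : ℂ)))
    (ε t : ℝ) (P : Finset ι) (Q : Finset κ) (hP : ∀ p ∈ P, ε * α p < t)
    (hQ : ∀ q ∈ Q, t ≤ ε * β q) :
    P.card + Q.card ≤ Fintype.card ι := by
  obtain ⟨U, hU, hAU⟩ := hAh.exists_unitary_eq_of_charpoly_eq hA
  obtain ⟨V, hV, hBV⟩ := (hAh.submatrix J).exists_unitary_eq_of_charpoly_eq hB
  rw [Matrix.star_eq_conjTranspose] at hAU hBV
  have hU' : U * Uᴴ = 1 := Matrix.mem_unitaryGroup_iff.1 hU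
  have hU'' : Uᴴ * U = 1 := Matrix.mem_unitaryGroup_iff'.1 hU
  have hV' : Vᴴ * V = 1 := Matrix.mem_unitaryGroup_iff'.1 hV
  let S : Matrix ι κ ℂ := (1 : Matrix ι ι ℂ).submatrix id J
  have hS (N : Matrix ι ι ℂ) : Sᴴ * N * S = N.submatrix J J := by
    ext i j
    simp [S, Matrix.mul_apply, Matrix.one_apply]
  have hSS : Sᴴ * S = 1 := by
    have := hS 1
    rwa [Matrix.mul_one, Matrix.submatrix_one _ hJ] at this
  let T : Matrix ι κ ℂ := Uᴴ * S * V
  have hTT : Tᴴ * T = 1 := by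
    calc Tᴴ * T = Vᴴ * (Sᴴ * (U * Uᴴ) * S) * V := by
          simp only [T, Matrix.conjTranspose_mul, Matrix.conjTranspose_conjTranspose,
            Matrix.mul_assoc]
      _ = 1 := by rw [hU', Matrix.mul_one, hSS, Matrix.mul_one, hV']
  have hTα : Tᴴ * Matrix.diagonal (fun i => (α i : ℂ)) * T =
      Matrix.diagonal fun i => (β i : ℂ) := by
    calc _ = Vᴴ * (Sᴴ * (U * Matrix.diagonal (fun i => (α i : ℂ)) * Uᴴ) * S) * V := by
          simp only [T, Matrix.conjTranspose_mul, Matrix.conjTranspose_conjTranspose,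
            Matrix.mul_assoc]
      _ = (Vᴴ * V) * Matrix.diagonal (fun i => (β i : ℂ)) * (Vᴴ * V) := by
          rw [← hAU, hS, hBV]
          simp only [Matrix.mul_assoc]
      _ = _ := by rw [hV', Matrix.one_mul, Matrix.mul_one]
  have hεα : Tᴴ * Matrix.diagonal (fun i => ((ε * α i : ℝ) : ℂ)) * T =
      Matrix.diagonal fun i => ((ε * β i : ℝ) : ℂ) := by
    rw [Matrix.diagonal_ofReal_mul, Matrix.diagonal_ofReal_mul, Matrix.mul_smul, Matrix.smul_mul,
      hTα]
  have hcol (N : Matrix ι ι ℂ) :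
      (T.submatrix id ((↑) : Q → κ))ᴴ * N * T.submatrix id ((↑) : Q → κ) =
        (Tᴴ * N * T).submatrix (↑) (↑) := by
    ext i j
    simp [Matrix.mul_apply]
  have := Matrix.card_add_card_le_of_isometry (T := T.submatrix id ((↑) : Q → κ))
    (α := fun i => ε * α i) (β := fun q : Q => ε * β q)
    (by
      have := hcol 1
      rwa [Matrix.mul_one, Matrix.mul_one, hTT,
        Matrix.submatrix_one _ Subtype.val_injective] at this)
    (by
      rw [hcol, hεα]
      exact Matrix.submatrix_diagonal _ _ Subtype.val_injective)
    t P hP fun q => hQ q q.2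
  rwa [Fintype.card_coe] at this

/-- **Cauchy interlacing**: decreasingly ordered eigenvalues of a principal submatrix of
codimension one interlace those of the matrix. -/
theorem Matrix.IsHermitian.interlacing_of_submatrix {m : ℕ}
    {A : Matrix (Fin (m + 1)) (Fin (m + 1)) ℂ}
    (hAh : A.IsHermitian) {J : Fin m → Fin (m + 1)} (hJ : Function.Injective J)
    {α : Fin (m + 1) → ℝ} {β : Fin m → ℝ} (hα : Antitone α) (hβ : Antitone β)
    (hA : A.charpoly = ∏ i, (X - C (α i : ℂ)))
    (hB : (A.submatrix J J).charpoly = ∏ i, (X - C (β i : ℂ))) (i : Fin m) :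
    β i ≤ α i.castSucc ∧ α i.succ ≤ β i := by
  constructor <;> by_contra! hlt
  · have := hAh.card_add_card_le_of_submatrix hJ hA hB 1 (β i) (Finset.Ici i.castSucc)
      (Finset.Iic i)
      (fun p hp => by simpa using (hα (Finset.mem_Ici.1 hp)).trans_lt hlt)
      (fun q hq => by simpa using hβ (Finset.mem_Iic.1 hq))
    simp at this
    omega
  · have := hAh.card_add_card_le_of_submatrix hJ hA hB (-1) (-β i) (Finset.Iic i.succ)
      (Finset.Ici i)
      (fun p hp => by simpa using hlt.trans_le (hα (Finset.mem_Iic.1 hp)))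
      (fun q hq => by simpa using hβ (Finset.mem_Ici.1 hq))
    simp at this
    omega

/-- Reindexing a product over `1, …, k` by `Fin k`. -/
theorem Finset.prod_Icc_one_eq_prod_fin {M : Type*} [CommMonoid M] (f : ℕ → M) (k : ℕ) :
    ∏ i ∈ Finset.Icc 1 k, f i = ∏ i : Fin k, f (i + 1) := by
  rw [Fin.prod_univ_eq_prod_range (fun i => f (i + 1)), Finset.range_eq_Ico,
    Finset.prod_Ico_add' f 0 k 1]
  rfl

/-- Let `n ≥ 1` and `λ₁ ≥ ⋯ ≥ λₙ` (1-based, `lam i` for `1 ≤ i ≤ n`).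
A tuple `u i k` (for `1 ≤ i ≤ k ≤ n - 1`), extended by `u i n = lam i`, arises as the tuple of
`i`-th largest eigenvalues of the `k × k` leading principal submatrices of some `n × n` Hermitian
matrix with characteristic polynomial `∏ (X - λᵢ)` (being the `i`-th largest eigenvalue of a
`k × k` Hermitian matrix is encoded by: the column `u · k` is non-increasing and the
characteristic polynomial of the submatrix equals `∏_{i=1}^{k} (X - u i k)`) if and only if the
Gelfand–Cetlin inequalities `u i (k+1) ≥ u i k ≥ u (i+1) (k+1)` hold for all `1 ≤ i ≤ k ≤ n-1`. -/
theorem statement0 (n : ℕ) (hn : 1 ≤ n) (lam : ℕ → ℝ)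
    (hlam : ∀ i, 1 ≤ i → i < n → lam (i + 1) ≤ lam i)
    (u : ℕ → ℕ → ℝ) (hun : ∀ i, 1 ≤ i → i ≤ n → u i n = lam i) :
    (∃ x : Matrix (Fin n) (Fin n) ℂ, x.IsHermitian ∧
        x.charpoly = ∏ i ∈ Finset.Icc 1 n, (X - C (lam i : ℂ)) ∧
        ∀ k, ∀ hk1 : 1 ≤ k, ∀ hk2 : k ≤ n - 1,
          (∀ i, 1 ≤ i → i < k → u (i + 1) k ≤ u i k) ∧
          (x.submatrix (Fin.castLE (show k ≤ n by omega))
              (Fin.castLE (show k ≤ n by omega))).charpoly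
            = ∏ i ∈ Finset.Icc 1 k, (X - C (u i k : ℂ))) ↔
    (∀ k i, 1 ≤ i → i ≤ k → k ≤ n - 1 →
        u i k ≤ u i (k + 1) ∧ u (i + 1) (k + 1) ≤ u i k) := by
  have hlast : ∀ x : Matrix (Fin n) (Fin n) ℂ,
      x.charpoly = ∏ i ∈ Finset.Icc 1 n, (X - C (lam i : ℂ)) ↔
        (x.submatrix (Fin.castLE le_rfl) (Fin.castLE le_rfl)).charpoly =
          ∏ i : Fin n, (X - C (u (i + 1) n : ℂ)) := fun x => by
    rw [Finset.prod_Icc_one_eq_prod_fin,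
      Finset.prod_congr rfl fun i _ => by rw [← hun (i + 1) (by omega) (by omega)]]
    rfl
  constructor
  · rintro ⟨x, hx, hxn, hxk⟩
    have hanti : ∀ k ≤ n, Antitone fun i : Fin k => u (i + 1) k := fun k hk => by
      have hstep : ∀ i, 1 ≤ i → i < k → u (i + 1) k ≤ u i k := fun i h1 h2 => by
        rcases hk.lt_or_eq with hk' | rfl
        · exact (hxk k (by omega) (by omega)).1 i h1 h2
        · rw [hun i h1 h2.le, hun (i + 1) (by omega) h2]
          exact hlam i h1 h2
      rintro ⟨i, hi⟩ ⟨j, hj⟩ (hij : i ≤ j)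
      change u (j + 1) k ≤ u (i + 1) k
      induction j, hij using Nat.le_induction with
      | base => exact le_rfl
      | succ j hij ih => exact (hstep (j + 1) (by omega) hj).trans (ih (by omega))
    have hchar : ∀ k, 1 ≤ k → ∀ hk : k ≤ n,
        (x.submatrix (Fin.castLE hk) (Fin.castLE hk)).charpoly =
          ∏ i : Fin k, (X - C (u (i + 1) k : ℂ)) := fun k h1 hk => by
      rcases hk.lt_or_eq with hk' | rfl
      · rw [(hxk k h1 (by omega)).2, Finset.prod_Icc_one_eq_prod_fin]
      · exact (hlast x).1 hxn
    intro k i h1 h2 h3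
    obtain ⟨i, rfl⟩ : ∃ j, i = j + 1 := ⟨i - 1, by omega⟩
    exact (hx.submatrix (Fin.castLE (show k + 1 ≤ n by omega))).interlacing_of_submatrix
      (Fin.castSucc_injective k) (hanti (k + 1) (by omega)) (hanti k (by omega))
      (hchar (k + 1) (by omega) _) (hchar k (by omega) (by omega)) ⟨i, h2⟩
  · intro h
    obtain ⟨x, hx, hxu⟩ := exists_isHermitian_of_gelfandCetlin u n
      fun k i h1 h2 h3 => h k i h1 h2 (by omega)
    refine ⟨x, hx, (hlast x).2 (hxu n le_rfl), fun k h1 h2 => ⟨fun i hi hik => ?_, ?_⟩⟩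
    · exact (h k (i + 1) (by omega) hik h2).1.trans (h k i hi hik.le h2).2
    · rw [Finset.prod_Icc_one_eq_prod_fin]
      exact hxu k (by omega)
end

section
/- Let 1 ≤ j and ℓ ≥ 1 with j + ℓ ≤ k, and suppose a_j > b_j = a_{j+1} = ⋯ = a_{j+ℓ} = b_{j+ℓ} > a_{j+ℓ+1}. Then there exists a unique positive real number C_j such that every z = (z₁, …, z_k) ∈ Ã_{k+1}(a, b) satisfies |z_j|² + |z_{j+1}|² + ⋯ + |z_{j+ℓ}|² = C_j. -/
open Polynomial

/-- The `(k+1) × (k+1)` Hermitian "arrow" matrix whose upper-left `k × k` block is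
`diag(b 1, …, b k)`, whose `(i, k+1)` entry is `conj (z i)` and `(k+1, i)` entry is `z i`
for `1 ≤ i ≤ k` (1-based indexing of the sequences), and whose `(k+1, k+1)` entry is `w`. -/
def Zarrow (k : ℕ) (b : ℕ → ℝ) (w : ℝ) (z : ℕ → ℂ) :
    Matrix (Fin (k + 1)) (Fin (k + 1)) ℂ :=
  Matrix.of fun i j =>
    if (i : ℕ) < k then
      if (j : ℕ) < k then (if i = j then (b ((i : ℕ) + 1) : ℂ) else 0)
      else (starRingEnd ℂ) (z ((i : ℕ) + 1))
    else
      if (j : ℕ) < k then z ((j : ℕ) + 1)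
      else (w : ℂ)

/-- The matrix `Z_{(a,b)}(z)`: the arrow matrix with corner entry
`z_{k+1} = Σ_{i=1}^{k+1} aᵢ − Σ_{i=1}^{k} bᵢ`. -/
def Zab (k : ℕ) (a b : ℕ → ℝ) (z : ℕ → ℂ) : Matrix (Fin (k + 1)) (Fin (k + 1)) ℂ :=
  Zarrow k b ((∑ i ∈ Finset.Icc 1 (k + 1), a i) - ∑ i ∈ Finset.Icc 1 k, b i) z

/-- `Ã_{k+1}(a, b)`: those `z` (with relevant coordinates `z 1, …, z k`) for which
`Z_{(a,b)}(z)` has characteristic polynomial `∏_{i=1}^{k+1}(X − aᵢ)`. -/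
def Atilde (k : ℕ) (a b : ℕ → ℝ) : Set (ℕ → ℂ) :=
  {z | (Zab k a b z).charpoly = ∏ i ∈ Finset.Icc 1 (k + 1), (X - C (a i : ℂ))}

/-- The monic polynomial attached to an arrow matrix with diagonal `b`, corner `w` and squared
off-diagonal moduli `c`. -/
noncomputable def arrowPoly {ι R : Type*} [DecidableEq ι] [CommRing R] (U : Finset ι)
    (b c : ι → R) (w : R) : R[X] :=
  (X - C w) * ∏ i ∈ U, (X - C (b i)) - ∑ i ∈ U, C (c i) * ∏ m ∈ U.erase i, (X - C (b m))

theorem prod_sub_eq_of_arrowPoly_eq {ι κ F : Type*} [DecidableEq ι]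
    [DecidableEq κ] [Field F] {U S : Finset ι} {V T : Finset κ} {a : κ → F} {b c : ι → F} {w β : F}
    (h : arrowPoly U b c w = ∏ i ∈ V, (X - C (a i)))
    (hSU : S ⊆ U) (hTV : T ⊆ V) (hb : ∀ i ∈ S, b i = β) (ha : ∀ i ∈ T, a i = β)
    (hcard : S.card = T.card + 1) :
    ∏ i ∈ V \ T, (β - a i) = -(∑ i ∈ S, c i) * ∏ i ∈ U \ S, (β - b i) := by
  have hS : ∏ i ∈ S, (X - C (b i)) = (X - C β) ^ (T.card + 1) := by
    rw [Finset.prod_congr rfl fun i hi => by rw [hb i hi], Finset.prod_const, hcard]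
  have hT : ∏ i ∈ T, (X - C (a i)) = (X - C β) ^ T.card := by
    rw [Finset.prod_congr rfl fun i hi => by rw [ha i hi], Finset.prod_const]
  have hin : ∀ i ∈ S, ∏ m ∈ U.erase i, (X - C (b m)) =
      (X - C β) ^ T.card * ∏ m ∈ U \ S, (X - C (b m)) := by
    intro i hi
    have h1 := Finset.mul_prod_erase U (fun m => X - C (b m)) (hSU hi)
    rw [← Finset.prod_sdiff hSU, hS, hb i hi] at h1
    apply mul_left_cancel₀ (X_sub_C_ne_zero β)
    rw [h1]; ring
  have hout : ∀ i ∈ U \ S, ∏ m ∈ U.erase i, (X - C (b m)) =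
      (X - C β) ^ (T.card + 1) * ∏ m ∈ (U \ S).erase i, (X - C (b m)) := by
    intro i hi
    have hi' := Finset.mem_sdiff.1 hi
    have h1 := Finset.mul_prod_erase U (fun m => X - C (b m)) hi'.1
    rw [← Finset.prod_sdiff hSU, hS, ← Finset.mul_prod_erase _ _ hi] at h1
    apply mul_left_cancel₀ (X_sub_C_ne_zero (b i))
    rw [h1]; ring
  rw [arrowPoly, ← Finset.prod_sdiff hSU, ← Finset.prod_sdiff hTV, ← Finset.sum_sdiff hSU, hS, hT,
    Finset.sum_congr (s₁ := S) (g := fun i => C (c i) * ((X - C β) ^ T.card *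
      ∏ m ∈ U \ S, (X - C (b m)))) rfl fun i hi => by rw [hin i hi],
    Finset.sum_congr (s₁ := U \ S) (g := fun i => C (c i) * ((X - C β) ^ (T.card + 1) *
      ∏ m ∈ (U \ S).erase i, (X - C (b m)))) rfl fun i hi => by rw [hout i hi]] at h
  have h2 : (X - C w) * (X - C β) * ∏ i ∈ U \ S, (X - C (b i))
      - (X - C β) * ∑ i ∈ U \ S, C (c i) * ∏ m ∈ (U \ S).erase i, (X - C (b m))
      - (∑ i ∈ S, C (c i)) * ∏ m ∈ U \ S, (X - C (b m)) = ∏ i ∈ V \ T, (X - C (a i)) := by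
    apply mul_left_cancel₀ (pow_ne_zero T.card (X_sub_C_ne_zero β))
    rw [mul_comm _ (∏ i ∈ V \ T, (X - C (a i))), ← h]
    simp_rw [mul_left_comm (C _) ((X - C β) ^ _), ← Finset.mul_sum, ← Finset.sum_mul]
    ring
  have h3 := congrArg (eval β) h2
  simp only [eval_sub, eval_mul, eval_X, eval_C, sub_self, mul_zero, zero_mul, eval_prod,
    eval_finsetSum] at h3
  rw [← h3]; ring

theorem charpoly_Zarrow (k : ℕ) (b : ℕ → ℝ) (w : ℝ) (z : ℕ → ℂ) :
    (Zarrow k b w z).charpoly =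
      arrowPoly Finset.univ (fun i : Fin k => (b (i + 1) : ℂ))
        (fun i => (Complex.normSq (z (i + 1)) : ℂ)) w := by
  apply Polynomial.eq_of_infinite_eval_eq
  have hfin : (Set.range fun i : Fin k => (b (i + 1) : ℂ)).Finite := Set.finite_range _
  refine hfin.infinite_compl.mono fun x hx => ?_
  have hne : ∀ i : Fin k, x - b (i + 1) ≠ 0 := fun i hi =>
    hx ⟨i, (sub_eq_zero.1 hi).symm⟩
  have hblock : (Matrix.scalar (Fin (k + 1)) x - Zarrow k b w z).submatrix
      (finSumFinEquiv (m := k) (n := 1)) finSumFinEquiv =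
      Matrix.fromBlocks (Matrix.diagonal fun i : Fin k => x - b (i + 1))
        (Matrix.of fun i _ => -(starRingEnd ℂ) (z (i + 1)))
        (Matrix.of fun _ i => -z (i + 1)) (Matrix.of fun _ _ => x - w) := by
    ext i j
    rcases i with i | i <;> rcases j with j | j
    · simp [Zarrow, Matrix.diagonal_apply, Fin.ext_iff]
      split_ifs <;> simp
    · simp [Zarrow, Matrix.diagonal_apply, Fin.ext_iff]
      omega
    · simp [Zarrow, Matrix.diagonal_apply, Fin.ext_iff]
      omega
    · simp [Zarrow, Matrix.diagonal_apply, Fin.ext_iff]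
  let _ : Invertible (Matrix.diagonal fun i : Fin k => x - (b (i + 1) : ℂ)) :=
    Matrix.invertibleOfIsUnitDet _ (by
      rw [Matrix.det_diagonal, isUnit_iff_ne_zero]
      exact Finset.prod_ne_zero_iff.2 fun i _ => hne i)
  have hinv : (⅟(Matrix.diagonal fun i : Fin k => x - (b (i + 1) : ℂ))) =
      Matrix.diagonal fun i : Fin k => (x - (b (i + 1) : ℂ))⁻¹ := by
    apply invOf_eq_right_inv
    rw [Matrix.diagonal_mul_diagonal, ← Matrix.diagonal_one]
    congr 1; ext i; exact mul_inv_cancel₀ (hne i)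
  show eval x _ = eval x _
  rw [Matrix.eval_charpoly, ← Matrix.det_submatrix_equiv_self (finSumFinEquiv (m := k) (n := 1)),
    hblock, Matrix.det_fromBlocks₁₁, hinv, Matrix.det_diagonal]
  simp only [arrowPoly, Matrix.det_unique, Matrix.sub_apply, Matrix.mul_apply (N := Matrix.of _),
    Matrix.mul_diagonal, Matrix.of_apply, eval_sub, eval_mul, eval_X, eval_C, eval_prod, eval_finsetSum, mul_sub,
    Finset.mul_sum]
  rw [mul_comm (x - (w : ℂ)), mul_sub]
  congr 1
  refine Finset.sum_congr rfl fun i hi => ?_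
  rw [← Finset.mul_prod_erase _ _ hi, Complex.normSq_eq_conj_mul_self]
  field_simp [hne i]

theorem degree_prod_sub_prod_lt {R : Type*} [CommRing R] [Nontrivial R] {n : ℕ}
    (u v : Fin (n + 1) → R) (h : ∑ i, u i = ∑ i, v i) :
    (∏ i, (X - C (u i)) - ∏ i, (X - C (v i))).degree < (n : WithBot ℕ) := by
  have hdeg : ∀ f : Fin (n + 1) → R, (∏ i, (X - C (f i))).natDegree = n + 1 := fun f => by
    rw [natDegree_prod_of_monic _ _ fun i _ => monic_X_sub_C (f i)]; simp
  have hmon : ∀ f : Fin (n + 1) → R, (∏ i, (X - C (f i))).Monic := fun f =>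
    monic_prod_of_monic _ _ fun i _ => monic_X_sub_C (f i)
  have hlead : ∀ f : Fin (n + 1) → R, (∏ i, (X - C (f i))).coeff (n + 1) = 1 := fun f => by
    have := (hmon f).coeff_natDegree
    rwa [hdeg f] at this
  have hnext : ∀ f : Fin (n + 1) → R, (∏ i, (X - C (f i))).coeff n = -∑ i, f i := fun f => by
    rw [← prod_X_sub_C_nextCoeff, nextCoeff_of_natDegree_pos (by rw [hdeg]; omega), hdeg]; rfl
  rw [degree_lt_iff_coeff_zero]
  intro m hm
  rw [coeff_sub]
  rcases hm.eq_or_lt with rfl | hm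
  · rw [hnext, hnext, h, sub_self]
  rcases (Nat.succ_le_of_lt hm).eq_or_lt with rfl | hm
  · rw [Nat.succ_eq_add_one, hlead, hlead, sub_self]
  · rw [coeff_eq_zero_of_natDegree_lt (by rw [hdeg]; exact hm),
      coeff_eq_zero_of_natDegree_lt (by rw [hdeg]; exact hm), sub_self]

theorem exists_arrowPoly_eq_of_strict {k : ℕ} (a : Fin (k + 1) → ℝ) (b : Fin k → ℝ)
    (h1 : ∀ i j, j ≤ i.castSucc → b i < a j) (h2 : ∀ i j, i.castSucc < j → a j < b i) :
    ∃ c : Fin k → ℝ, (∀ i, 0 ≤ c i) ∧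
      arrowPoly Finset.univ b c (∑ i, a i - ∑ i, b i) = ∏ i, (X - C (a i)) := by
  have hanti : StrictAnti b := fun i m him =>
    (h1 m m.castSucc le_rfl).trans (h2 i m.castSucc (by simpa using him))
  have hne : ∀ i, ∏ m ∈ Finset.univ.erase i, (b i - b m) ≠ 0 := fun i =>
    Finset.prod_ne_zero_iff.2 fun m hm =>
      sub_ne_zero.2 fun h => Finset.ne_of_mem_erase hm (hanti.injective h).symm
  refine ⟨fun i => -(∏ j, (b i - a j)) / ∏ m ∈ Finset.univ.erase i, (b i - b m),
    fun i => ?_, ?_⟩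
  · beta_reduce
    rw [Fin.prod_univ_succAbove _ i.castSucc, ← Finset.mul_prod_erase _ _ (Finset.mem_univ i),
      ← neg_mul, neg_sub, ← mul_assoc, mul_div_assoc, ← Finset.prod_div_distrib]
    refine mul_nonneg (mul_nonneg (sub_nonneg.2 (h1 i _ le_rfl).le) (sub_nonneg.2 ?_))
      (Finset.prod_nonneg fun m hm => ?_)
    · rw [Fin.succAbove_castSucc_self]
      exact (h2 i _ (Fin.castSucc_lt_succ)).le
    · rcases lt_or_gt_of_ne (Finset.ne_of_mem_erase hm) with hmi | hmi
      · have h : m.castSucc < i.castSucc := by simpa using hmi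
        rw [Fin.succAbove_of_castSucc_lt _ _ h]
        exact div_nonneg_of_nonpos (sub_nonpos.2 (h1 i _ h.le).le) (sub_nonpos.2 (hanti hmi).le)
      · have h : i.castSucc < m.castSucc := by simpa using hmi
        rw [Fin.succAbove_of_le_castSucc _ _ h.le]
        exact div_nonneg (sub_nonneg.2 (h2 i _ (h.trans Fin.castSucc_lt_succ)).le)
          (sub_nonneg.2 (hanti hmi).le)
  · set c : Fin k → ℝ := fun i => -(∏ j, (b i - a j)) / ∏ m ∈ Finset.univ.erase i, (b i - b m)
    rw [← sub_eq_zero]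
    refine eq_zero_of_degree_lt_of_eval_index_eq_zero Finset.univ
      (hanti.injective.injOn) ?_ fun i _ => ?_
    · have hcons : (X - C (∑ i, a i - ∑ i, b i)) * ∏ i, (X - C (b i)) =
          ∏ i, (X - C ((Fin.cons (∑ i, a i - ∑ i, b i) b : Fin (k + 1) → ℝ) i)) := by
        simp [Fin.prod_univ_succ (n := k)]
      rw [arrowPoly, sub_right_comm, hcons]
      refine (degree_sub_le _ _).trans_lt (max_lt ?_ ?_)
      · simpa using degree_prod_sub_prod_lt _ a (by simp [Fin.sum_univ_succ (n := k)])
      · refine (degree_sum_le _ _).trans_lt ((Finset.sup_lt_iff ?_).2 fun i _ => ?_)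
        · exact WithBot.bot_lt_coe _
        · rw [← smul_eq_C_mul]
          refine (degree_smul_le _ _).trans_lt ?_
          rw [degree_prod]
          simp
          exact i.pos
    · rw [arrowPoly]
      simp only [eval_sub, eval_mul, eval_X, eval_C, eval_prod, eval_finsetSum]
      have hsum : ∑ n, c n * ∏ m ∈ Finset.univ.erase n, (b i - b m) = -∏ j, (b i - a j) := by
        rw [Finset.sum_eq_single i]
        · exact div_mul_cancel₀ _ (hne i)
        · intro m _ hm
          rw [Finset.prod_eq_zero (i := i) (Finset.mem_erase.2 ⟨hm.symm, Finset.mem_univ i⟩)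
            (sub_self (b i)), mul_zero]
        · simp
      rw [Finset.prod_eq_zero (Finset.mem_univ i) (sub_self (b i)), hsum]
      ring

theorem arrowPoly_univ_insertNth {R : Type*} [CommRing R] {k : ℕ} (i : Fin (k + 1))
    (b : Fin (k + 1) → R) (c : Fin k → R) (w : R) :
    arrowPoly Finset.univ b (i.insertNth 0 c) w =
      (X - C (b i)) * arrowPoly Finset.univ (b ∘ i.succAbove) c w := by
  have h : ∀ m : Fin k, ∏ n ∈ Finset.univ.erase (i.succAbove m), (X - C (b n)) =
      (X - C (b i)) * ∏ n ∈ Finset.univ.erase m, (X - C (b (i.succAbove n))) := by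
    intro m
    rw [← Finset.mul_prod_erase _ _
      (Finset.mem_erase.2 ⟨(Fin.succAbove_ne i m).symm, Finset.mem_univ i⟩)]
    congr 1
    symm
    refine Finset.prod_bij (fun n _ => i.succAbove n) ?_ ?_ ?_ ?_
    · intro n hn; simpa [Fin.succAbove_ne] using hn
    · intro n _ n' _ hnn; exact Fin.succAbove_right_injective hnn
    · intro n hn
      simp only [Finset.mem_erase, Finset.mem_univ, and_true] at hn
      obtain ⟨m', rfl⟩ := Fin.exists_succAbove_eq hn.1
      exact ⟨m', by simpa using hn.2, rfl⟩
    · intro n _; rfl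
  rw [arrowPoly, arrowPoly, Fin.prod_univ_succAbove _ i, Fin.sum_univ_succAbove _ i]
  simp only [Fin.insertNth_apply_same, Fin.insertNth_apply_succAbove, h, Function.comp_apply,
    map_zero, zero_mul, zero_add]
  rw [mul_sub, Finset.mul_sum]
  refine congrArg₂ HSub.hSub ?_ ?_
  · ring
  · exact Finset.sum_congr rfl fun m _ => by ring

theorem succAbove_le_castSucc_succAbove {k : ℕ} {i : Fin (k + 1)} {p : Fin (k + 2)}
    (hp : p = i.castSucc ∨ p = i.succ) {m : Fin k} {n : Fin (k + 1)} (h : n ≤ m.castSucc) :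
    p.succAbove n ≤ (i.succAbove m).castSucc := by
  have hp' : (p : ℕ) = i ∨ (p : ℕ) = i + 1 := by rcases hp with rfl | rfl <;> simp
  simp only [Fin.succAbove, Fin.le_def, Fin.lt_def, Fin.val_castSucc] at *
  split_ifs <;> simp only [Fin.val_castSucc, Fin.val_succ] at * <;> omega

theorem castSucc_succAbove_lt_succAbove {k : ℕ} {i : Fin (k + 1)} {p : Fin (k + 2)}
    (hp : p = i.castSucc ∨ p = i.succ) {m : Fin k} {n : Fin (k + 1)} (h : m.castSucc < n) :
    (i.succAbove m).castSucc < p.succAbove n := by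
  have hp' : (p : ℕ) = i ∨ (p : ℕ) = i + 1 := by rcases hp with rfl | rfl <;> simp
  simp only [Fin.succAbove, Fin.lt_def, Fin.val_castSucc] at *
  split_ifs <;> simp only [Fin.val_castSucc, Fin.val_succ] at * <;> omega

theorem exists_arrowPoly_eq {k : ℕ} (a : Fin (k + 1) → ℝ) (b : Fin k → ℝ)
    (h1 : ∀ i j, j ≤ i.castSucc → b i ≤ a j) (h2 : ∀ i j, i.castSucc < j → a j ≤ b i) :
    ∃ c : Fin k → ℝ, (∀ i, 0 ≤ c i) ∧
      arrowPoly Finset.univ b c (∑ i, a i - ∑ i, b i) = ∏ i, (X - C (a i)) := by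
  induction k with
  | zero => exact exists_arrowPoly_eq_of_strict a b (fun i => i.elim0) (fun i => i.elim0)
  | succ k ih =>
    by_cases hs : ∃ (i : Fin (k + 1)) (p : Fin (k + 2)), a p = b i ∧
        (∀ m n, n ≤ m.castSucc → p.succAbove n ≤ (i.succAbove m).castSucc) ∧
        ∀ m n, m.castSucc < n → (i.succAbove m).castSucc < p.succAbove n
    · obtain ⟨i, p, hpi, hle, hlt⟩ := hs
      obtain ⟨c, hc, hca⟩ := ih (a ∘ p.succAbove) (b ∘ i.succAbove)
        (fun m n hmn => h1 _ _ (hle m n hmn)) (fun m n hmn => h2 _ _ (hlt m n hmn))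
      refine ⟨i.insertNth 0 c, fun m => ?_, ?_⟩
      · rcases Fin.eq_self_or_eq_succAbove i m with rfl | ⟨m, rfl⟩
        · simp
        · simpa using hc m
      · rw [arrowPoly_univ_insertNth, Fin.prod_univ_succAbove _ p, hpi, Fin.sum_univ_succAbove a p,
          Fin.sum_univ_succAbove b i, hpi, add_sub_add_left_eq_sub]
        exact congrArg _ hca
    · push Not at hs
      have hcast : ∀ i : Fin (k + 1), a i.castSucc ≠ b i := by
        intro i hi
        obtain ⟨m, n, hmn, hnm⟩ := hs i i.castSucc hi fun m n hmn =>
          succAbove_le_castSucc_succAbove (Or.inl rfl) hmn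
        exact hnm.not_gt (castSucc_succAbove_lt_succAbove (Or.inl rfl) hmn)
      have hsucc : ∀ i : Fin (k + 1), a i.succ ≠ b i := by
        intro i hi
        obtain ⟨m, n, hmn, hnm⟩ := hs i i.succ hi fun m n hmn =>
          succAbove_le_castSucc_succAbove (Or.inr rfl) hmn
        exact hnm.not_gt (castSucc_succAbove_lt_succAbove (Or.inr rfl) hmn)
      have hanti : Antitone a := Fin.antitone_iff_succ_le.2 fun i =>
        (h2 i _ Fin.castSucc_lt_succ).trans (h1 i _ le_rfl)
      refine exists_arrowPoly_eq_of_strict a b (fun i j hj => ?_) (fun i j hj => ?_)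
      · exact ((h1 i _ le_rfl).lt_of_ne (hcast i).symm).trans_le (hanti hj)
      · exact (hanti (Fin.castSucc_lt_iff_succ_le.1 hj)).trans_lt
          ((h2 i _ Fin.castSucc_lt_succ).lt_of_ne (hsucc i))

theorem map_arrowPoly {ι R S : Type*} [DecidableEq ι] [CommRing R] [CommRing S] (f : R →+* S)
    (U : Finset ι) (b c : ι → R) (w : R) :
    (arrowPoly U b c w).map f = arrowPoly U (fun i => f (b i)) (fun i => f (c i)) (f w) := by
  simp [arrowPoly, Polynomial.map_sum, Polynomial.map_prod]

theorem Icc_eq_map_filter_univ {n p q : ℕ} (hp : 1 ≤ p) (hq : q ≤ n) :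
    Finset.Icc p q = (Finset.univ.filter fun i : Fin n => p ≤ i + 1 ∧ (i : ℕ) + 1 ≤ q).map
      (Fin.valEmbedding.trans (addRightEmbedding 1)) := by
  ext m
  simp only [Finset.mem_Icc, Finset.mem_map, Finset.mem_filter, Finset.mem_univ, true_and,
    Function.Embedding.trans_apply, Fin.valEmbedding_apply, addRightEmbedding_apply]
  constructor
  · intro h
    exact ⟨⟨m - 1, by omega⟩, by simp only; omega, by simp only; omega⟩
  · rintro ⟨i, hi, rfl⟩
    exact hi

theorem Icc_one_eq_map_univ (n : ℕ) :
    Finset.Icc 1 n = (Finset.univ : Finset (Fin n)).map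
      (Fin.valEmbedding.trans (addRightEmbedding 1)) := by
  rw [Icc_eq_map_filter_univ le_rfl le_rfl, Finset.filter_true_of_mem]
  intro i _
  omega

theorem mem_Atilde_iff {k : ℕ} {a b : ℕ → ℝ} {z : ℕ → ℂ} :
    z ∈ Atilde k a b ↔
      arrowPoly Finset.univ (fun i : Fin k => (b (i + 1) : ℂ))
        (fun i => (Complex.normSq (z (i + 1)) : ℂ))
        ((∑ i : Fin (k + 1), a (i + 1) - ∑ i : Fin k, b (i + 1) : ℝ) : ℂ) =
      ∏ i : Fin (k + 1), (X - C (a (i + 1) : ℂ)) := by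
  rw [Atilde, Set.mem_ofPred_eq, Zab, charpoly_Zarrow, Icc_one_eq_map_univ, Icc_one_eq_map_univ,
    Finset.prod_map, Finset.sum_map, Finset.sum_map]
  rfl

theorem antitone_of_interlacing {k : ℕ} {a b : ℕ → ℝ}
    (hab : ∀ i, 1 ≤ i → i ≤ k → b i ≤ a i ∧ a (i + 1) ≤ b i) {m n : ℕ} (hm : 1 ≤ m)
    (hmn : m ≤ n) (hn : n ≤ k + 1) : a n ≤ a m := by
  induction n, hmn using Nat.le_induction with
  | base => exact le_rfl
  | succ n hmn ih =>
    have h := hab n (by omega) (by omega)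
    exact (h.2.trans h.1).trans (ih (by omega))

theorem Atilde_nonempty {k : ℕ} {a b : ℕ → ℝ}
    (hab : ∀ i, 1 ≤ i → i ≤ k → b i ≤ a i ∧ a (i + 1) ≤ b i) : (Atilde k a b).Nonempty := by
  obtain ⟨c, hc, h⟩ := exists_arrowPoly_eq (fun i : Fin (k + 1) => a (i + 1))
    (fun i : Fin k => b (i + 1))
    (fun i j hij => by
      have hij' : (j : ℕ) ≤ i := hij
      exact (hab (i + 1) (by omega) (by omega)).1.trans
        (antitone_of_interlacing hab (by omega) (by omega) (by omega)))
    (fun i j hij => by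
      have hij' : (i : ℕ) < j := hij
      exact (antitone_of_interlacing hab (by omega) (by omega) (by omega)).trans
        (hab (i + 1) (by omega) (by omega)).2)
  refine ⟨fun n => if hn : n - 1 < k then (√(c ⟨n - 1, hn⟩) : ℂ) else 0, ?_⟩
  have h' := congrArg (Polynomial.map Complex.ofRealHom) h
  rw [map_arrowPoly, Polynomial.map_prod] at h'
  rw [mem_Atilde_iff]
  simpa [Complex.normSq_ofReal, Real.mul_self_sqrt (hc _)] using h'

/-- case (2).  Suppose `1 ≤ j`, `ℓ ≥ 1`, `j + ℓ ≤ k` and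
`a_j > b_j = a_{j+1} = ⋯ = a_{j+ℓ} = b_{j+ℓ} > a_{j+ℓ+1}` (1-based).  Then there is a unique
positive real `C` such that every `z ∈ Ã_{k+1}(a,b)` satisfies
`|z_j|² + |z_{j+1}|² + ⋯ + |z_{j+ℓ}|² = C`. -/
theorem statement9 (k : ℕ) (hk : 1 ≤ k) (a b : ℕ → ℝ)
    (hab : ∀ i, 1 ≤ i → i ≤ k → b i ≤ a i ∧ a (i + 1) ≤ b i)
    (j l : ℕ) (hj : 1 ≤ j) (hl : 1 ≤ l) (hjl : j + l ≤ k)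
    (hlt1 : b j < a j)
    (heq : ∀ m, j + 1 ≤ m → m ≤ j + l → a m = b j ∧ b m = b j)
    (hlt2 : a (j + l + 1) < b j) :
    ∃! C : ℝ, 0 < C ∧
      ∀ z ∈ Atilde k a b,
        (∑ i ∈ Finset.Icc j (j + l), Complex.normSq (z i)) = C := by
  have key : ∀ z ∈ Atilde k a b,
      ∏ i ∈ Finset.univ \ Finset.univ.filter fun i : Fin (k + 1) =>
          j + 1 ≤ i + 1 ∧ (i : ℕ) + 1 ≤ j + l, ((b j : ℂ) - a (i + 1)) =
        -((∑ i ∈ Finset.Icc j (j + l), Complex.normSq (z i) : ℝ) : ℂ) *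
          ∏ i ∈ Finset.univ \ Finset.univ.filter fun i : Fin k =>
            j ≤ i + 1 ∧ (i : ℕ) + 1 ≤ j + l, ((b j : ℂ) - b (i + 1)) := by
    intro z hz
    rw [Icc_eq_map_filter_univ hj hjl, Finset.sum_map, Complex.ofReal_sum]
    have h := mem_Atilde_iff.1 hz
    refine prod_sub_eq_of_arrowPoly_eq (U := Finset.univ) (V := Finset.univ)
      (a := fun i : Fin (k + 1) => (a (i + 1) : ℂ)) (b := fun i : Fin k => (b (i + 1) : ℂ))
      (c := fun i : Fin k => (Complex.normSq (z (i + 1)) : ℂ)) h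
      (Finset.subset_univ _) (Finset.subset_univ _) (fun i hi => ?_) (fun i hi => ?_) ?_
    · obtain ⟨h1, h2⟩ := (Finset.mem_filter.1 hi).2
      rcases h1.eq_or_lt with h1 | h1
      · rw [← h1]
      · rw [(heq _ h1 h2).2]
    · obtain ⟨h1, h2⟩ := (Finset.mem_filter.1 hi).2
      rw [(heq _ h1 h2).1]
    · have h1 := congrArg Finset.card (Icc_eq_map_filter_univ hj hjl)
      have h2 := congrArg Finset.card
        (Icc_eq_map_filter_univ (n := k + 1) (p := j + 1) (q := j + l) (by omega) (by omega))
      rw [Finset.card_map, Nat.card_Icc] at h1 h2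
      omega
  have hne : ∏ i ∈ Finset.univ \ Finset.univ.filter fun i : Fin (k + 1) =>
      j + 1 ≤ i + 1 ∧ (i : ℕ) + 1 ≤ j + l, ((b j : ℂ) - a (i + 1)) ≠ 0 := by
    refine Finset.prod_ne_zero_iff.2 fun i hi => sub_ne_zero.2 fun h => ?_
    have h : b j = a (i + 1) := Complex.ofReal_injective h
    simp only [Finset.mem_sdiff, Finset.mem_univ, Finset.mem_filter, true_and, not_and,
      not_le] at hi
    by_cases hij : j + 1 ≤ (i : ℕ) + 1
    · have := antitone_of_interlacing hab (m := j + l + 1) (n := i + 1) (by omega)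
        (by have := hi hij; omega) (by omega)
      linarith
    · have := antitone_of_interlacing hab (m := i + 1) (n := j) (by omega) (by omega) (by omega)
      linarith
  obtain ⟨z₀, hz₀⟩ := Atilde_nonempty hab
  have h₀ := key z₀ hz₀
  rw [h₀] at hne
  refine ⟨∑ i ∈ Finset.Icc j (j + l), Complex.normSq (z₀ i),
    ⟨(Finset.sum_nonneg fun i _ => Complex.normSq_nonneg _).lt_of_ne fun h => ?_,
      fun z hz => ?_⟩, fun C hC => (hC.2 z₀ hz₀).symm⟩
  · rw [← h] at hne
    simp at hne
  · have h := mul_right_cancel₀ (right_ne_zero_of_mul hne) ((key z hz).symm.trans h₀)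
    exact Complex.ofReal_injective (neg_injective h)
end

section
/- Let k ≥ 1 and let a₁ ≥ b₁ ≥ a₂ ≥ ⋯ ≥ a_k ≥ b_k ≥ a_{k+1} be real numbers. Let x and y be (k+1)×(k+1) complex Hermitian matrices such that the characteristic polynomials of x and y both equal ∏_{i=1}^{k+1}(X − a_i), and the characteristic polynomials of the k×k leading principal submatrices x^{(k)} and y^{(k)} both equal ∏_{i=1}^{k}(X − b_i). Then there exists a unitary k×k matrix g ∈ U(k) such that ι(g) · x · ι(g)* = y, where ι(g) is the (k+1)×(k+1) block-diagonal matrix with blocks g and 1. In other words, the embedded U(k) acts transitively on the set A_{k+1}(a, b) of Hermitian matrices with spectrum a whose k×k leading principal submatrix has spectrum b. -/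
open Polynomial Matrix

/-- `ι(g)`: the `(k+1) × (k+1)` block-diagonal matrix with upper-left `k × k` block `g`
and lower-right entry `1`. -/
def unitaryEmbed (k : ℕ) (g : Matrix (Fin k) (Fin k) ℂ) :
    Matrix (Fin (k + 1)) (Fin (k + 1)) ℂ :=
  Matrix.of fun i j =>
    if hi : (i : ℕ) < k then
      (if hj : (j : ℕ) < k then g ⟨i, hi⟩ ⟨j, hj⟩ else 0)
    else
      (if (j : ℕ) < k then 0 else 1)

lemma exists_unitary_commute_mulVec_eq {n : Type*} [Fintype n] [DecidableEq n] (d : n → ℝ)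
    (v w : n → ℂ)
    (h : ∀ μ, ∑ i with d i = μ, v i * star (v i) = ∑ i with d i = μ, w i * star (w i)) :
    ∃ G ∈ unitaryGroup n ℂ, Commute G (diagonal fun i => (d i : ℂ)) ∧ G *ᵥ v = w := by
  set u : n → ℂ := v - w with hu
  set s : ℝ → ℂ := fun μ => ∑ j with d j = μ, star (u j) * v j with hs
  have hnorm : ∀ μ, ∑ j with d j = μ, star (u j) * u j = s μ + star (s μ) := by
    intro μ
    have h1 : ∑ j with d j = μ, star (u j) * u j - s μ - star (s μ)
        = ∑ j with d j = μ, w j * star (w j) - ∑ j with d j = μ, v j * star (v j) := by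
      simp only [hs, star_sum, ← Finset.sum_sub_distrib]
      refine Finset.sum_congr rfl fun j _ => ?_
      simp only [hu, Pi.sub_apply, star_sub, star_mul', star_star]
      ring
    rw [h μ, sub_self] at h1
    linear_combination h1
  have hzero : ∀ i, s (d i) = 0 → u i = 0 := by
    intro i hi
    have h1 := hnorm (d i)
    rw [hi, star_zero, add_zero] at h1
    have h2 : ∑ j with d j = d i, ‖u j‖ ^ 2 = 0 := by
      have : ((∑ j with d j = d i, ‖u j‖ ^ 2 : ℝ) : ℂ) = 0 := by
        rw [← h1]
        push_cast
        exact Finset.sum_congr rfl fun j _ => (Complex.conj_mul' (u j)).symm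
      exact_mod_cast this
    rw [Finset.sum_eq_zero_iff_of_nonneg fun _ _ => by positivity] at h2
    simpa using h2 i (by simp)
  refine ⟨1 - of fun i j => if d j = d i then (s (d i))⁻¹ * (u i * star (u j)) else 0, ?_, ?_, ?_⟩
  · rw [mem_unitaryGroup_iff']
    set R : Matrix n n ℂ :=
      of fun i j => if d j = d i then (s (d i))⁻¹ * (u i * star (u j)) else 0 with hR
    have hRR : star R * R = R + star R := by
      ext i j
      simp only [star_eq_conjTranspose, mul_apply, conjTranspose_apply, Matrix.add_apply, hR, of_apply]
      by_cases hij : d j = d i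
      · have h1 : ∀ l, star (if d i = d l then (s (d l))⁻¹ * (u l * star (u i)) else 0) *
            (if d j = d l then (s (d l))⁻¹ * (u l * star (u j)) else 0) =
            if d l = d i then (star (s (d i))⁻¹ * (s (d i))⁻¹ * (u i * star (u j))) *
              (star (u l) * u l) else 0 := by
          intro l
          by_cases hl : d l = d i
          · simp only [hl, hij, if_true, star_mul', star_star]
            ring
          · simp [hl, Ne.symm hl]
        rw [Finset.sum_congr rfl fun l _ => h1 l, ← Finset.sum_filter, ← Finset.mul_sum, hnorm]
        simp only [hij, if_true, star_mul', star_star]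
        by_cases h0 : s (d i) = 0
        · simp [h0]
        · have h0' : star (s (d i)) ≠ 0 := star_ne_zero.2 h0
          rw [star_inv₀]
          field_simp
          ring
      · have h1 : ∀ l, star (if d i = d l then (s (d l))⁻¹ * (u l * star (u i)) else 0) *
            (if d j = d l then (s (d l))⁻¹ * (u l * star (u j)) else 0) = 0 := by
          intro l
          by_cases hl : d i = d l
          · simp [← hl, hij]
          · simp [hl]
        rw [Finset.sum_congr rfl fun l _ => h1 l]
        simp [hij, Ne.symm hij]
    rw [star_sub, star_one, sub_mul, mul_sub, mul_sub, hRR]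
    simp
  · rw [commute_iff_eq, sub_mul, mul_sub, one_mul, mul_one]
    congr 1
    ext i j
    simp only [mul_diagonal, diagonal_mul, of_apply]
    split_ifs with hij
    · rw [hij]; ring
    · simp
  · ext i
    rw [sub_mulVec, one_mulVec]
    simp only [Pi.sub_apply, mulVec, dotProduct, of_apply, ite_mul, zero_mul]
    rw [← Finset.sum_filter, Finset.sum_congr rfl fun j _ =>
      show (s (d i))⁻¹ * (u i * star (u j)) * v j = (s (d i))⁻¹ * u i * (star (u j) * v j) by ring,
      ← Finset.mul_sum]
    change v i - (s (d i))⁻¹ * u i * s (d i) = w i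
    by_cases h0 : s (d i) = 0
    · have := hzero i h0
      simp only [hu, Pi.sub_apply, sub_eq_zero] at this
      simp [h0, this]
    · field_simp
      simp [hu]

lemma sum_filter_eq_zero_of_sum_div_eq_zero {n K : Type*} [Fintype n] [Field K] [Infinite K]
    [DecidableEq K] (d f : n → K)
    (h : ∀ t, (∀ i, t ≠ d i) → ∑ i, f i / (t - d i) = 0) (μ : K) :
    ∑ i with d i = μ, f i = 0 := by
  set S : Finset K := Finset.univ.image d with hS
  have hdS : ∀ i, d i ∈ S := fun i => Finset.mem_image_of_mem _ (Finset.mem_univ i)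
  by_cases hμ : μ ∈ S
  swap
  · rw [Finset.filter_false_of_mem fun i _ (hi : d i = μ) => hμ (hi ▸ hdS i), Finset.sum_empty]
  set P : K[X] := ∑ i, C (f i) * ∏ ν ∈ S.erase (d i), (X - C ν) with hP
  have hP0 : P = 0 := by
    refine P.eq_zero_of_infinite_isRoot ((S.finite_toSet.infinite_compl).mono fun t ht => ?_)
    have ht' : ∀ i, t ≠ d i := fun i hi => ht (by simpa [hi] using hdS i)
    have : P.eval t = (∏ ν ∈ S, (t - ν)) * ∑ i, f i / (t - d i) := by
      simp only [hP, eval_finsetSum, eval_mul, eval_C, eval_prod, eval_sub, eval_X,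
        Finset.mul_sum]
      refine Finset.sum_congr rfl fun i _ => ?_
      rw [← Finset.mul_prod_erase S _ (hdS i)]
      have := sub_ne_zero.2 (ht' i)
      field_simp
    simp [IsRoot, this, h t ht']
  have hprod : (∏ ν ∈ S.erase μ, (μ - ν)) ≠ 0 :=
    Finset.prod_ne_zero_iff.2 fun ν hν => sub_ne_zero.2 (Finset.ne_of_mem_erase hν).symm
  have hev : P.eval μ = (∑ i with d i = μ, f i) * ∏ ν ∈ S.erase μ, (μ - ν) := by
    simp only [hP, eval_finsetSum, eval_mul, eval_C, eval_prod, eval_sub, eval_X,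
      Finset.sum_mul, Finset.sum_filter]
    refine Finset.sum_congr rfl fun i _ => ?_
    split_ifs with hi
    · rw [hi]
    · rw [Finset.prod_eq_zero (Finset.mem_erase.2 ⟨Ne.symm hi, hμ⟩) (sub_self μ), mul_zero,
        zero_mul]
  rw [hP0, eval_zero, zero_eq_mul] at hev
  exact hev.resolve_right hprod

lemma eval_charpoly_fromBlocks_diagonal {n K : Type*} [Fintype n] [DecidableEq n] [Field K]
    (d v w : n → K) (c : Matrix (Fin 1) (Fin 1) K) {t : K} (ht : ∀ i, t ≠ d i) :
    (fromBlocks (diagonal d) (replicateCol (Fin 1) v) (replicateRow (Fin 1) w) c).charpoly.eval t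
      = (∏ i, (t - d i)) * (t - c 0 0 - ∑ i, v i * w i / (t - d i)) := by
  have hsub : scalar (n ⊕ Fin 1) t
      - fromBlocks (diagonal d) (replicateCol (Fin 1) v) (replicateRow (Fin 1) w) c
      = fromBlocks (diagonal fun i => t - d i) (-replicateCol (Fin 1) v)
          (-replicateRow (Fin 1) w) (scalar (Fin 1) t - c) := by
    ext (i | i) (j | j)
    · by_cases hij : i = j <;> simp [hij]
    · simp
    · simp
    · simp [Subsingleton.elim i j]
  have hd : diagonal (fun i => (t - d i)⁻¹) * diagonal (fun i => t - d i) = 1 := by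
    rw [diagonal_mul_diagonal, ← diagonal_one]
    exact congrArg _ (funext fun i => inv_mul_cancel₀ (sub_ne_zero.2 (ht i)))
  let := invertibleOfLeftInverse _ _ hd
  rw [eval_charpoly, hsub, det_fromBlocks₁₁, det_diagonal, det_unique]
  congr 1
  rw [invOf_eq_left_inv hd]
  simp only [Fin.default_eq_zero, Matrix.neg_mul, Matrix.mul_neg, neg_neg,
    Matrix.sub_apply, scalar_apply, diagonal_apply_eq, mul_apply (M := _ * _), mul_diagonal,
    replicateRow_apply, replicateCol_apply]
  congr 1
  exact Finset.sum_congr rfl fun i _ => by ring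

lemma sum_filter_eq_of_charpoly_fromBlocks_diagonal_eq {n K : Type*} [Fintype n] [DecidableEq n]
    [Field K] [Infinite K] [DecidableEq K] (d v w v' w' : n → K) (c c' : Matrix (Fin 1) (Fin 1) K)
    (h : (fromBlocks (diagonal d) (replicateCol (Fin 1) v) (replicateRow (Fin 1) w) c).charpoly =
      (fromBlocks (diagonal d) (replicateCol (Fin 1) v') (replicateRow (Fin 1) w') c').charpoly) :
    c = c' ∧ ∀ μ, ∑ i with d i = μ, v i * w i = ∑ i with d i = μ, v' i * w' i := by
  have hc : c 0 0 = c' 0 0 := by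
    have htr := congrArg (fun p : K[X] => -p.nextCoeff) h
    simpa [← trace_eq_neg_charpoly_nextCoeff, trace, Fintype.sum_sum_type] using htr
  refine ⟨by ext i j; rwa [Subsingleton.elim i 0, Subsingleton.elim j 0], fun μ => ?_⟩
  rw [← sub_eq_zero, ← Finset.sum_sub_distrib]
  refine sum_filter_eq_zero_of_sum_div_eq_zero d (fun i => v i * w i - v' i * w' i)
    (fun t ht => ?_) μ
  have hev := congrArg (eval t) h
  rw [eval_charpoly_fromBlocks_diagonal d v w c ht,
    eval_charpoly_fromBlocks_diagonal d v' w' c' ht, hc] at hev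
  have := mul_left_cancel₀ (Finset.prod_ne_zero_iff.2 fun i _ => sub_ne_zero.2 (ht i)) hev
  simp only [sub_div, Finset.sum_sub_distrib]
  linear_combination -this

lemma fromBlocks_conj {n : Type*} [Fintype n] [DecidableEq n] (g A : Matrix n n ℂ) (v : n → ℂ)
    (c : Matrix (Fin 1) (Fin 1) ℂ) :
    fromBlocks g 0 0 1 * fromBlocks A (replicateCol (Fin 1) v) (replicateRow (Fin 1) (star v)) c
      * (fromBlocks g 0 0 1)ᴴ
      = fromBlocks (g * A * gᴴ) (replicateCol (Fin 1) (g *ᵥ v))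
          (replicateRow (Fin 1) (star (g *ᵥ v))) c := by
  simp [fromBlocks_conjTranspose, fromBlocks_multiply, replicateCol_mulVec, star_mulVec,
    replicateRow_vecMul]

lemma charpoly_fromBlocks_conj {n : Type*} [Fintype n] [DecidableEq n] {g : Matrix n n ℂ}
    (hg : g ∈ unitaryGroup n ℂ) (A : Matrix n n ℂ) (v : n → ℂ)
    (c : Matrix (Fin 1) (Fin 1) ℂ) :
    (fromBlocks (g * A * gᴴ) (replicateCol (Fin 1) (g *ᵥ v))
      (replicateRow (Fin 1) (star (g *ᵥ v))) c).charpoly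
      = (fromBlocks A (replicateCol (Fin 1) v)
          (replicateRow (Fin 1) (star v)) c).charpoly := by
  have hg' : gᴴ * g = 1 := mem_unitaryGroup_iff'.1 hg
  rw [← fromBlocks_conj, mul_assoc, charpoly_mul_comm, mul_assoc, fromBlocks_conjTranspose,
    fromBlocks_multiply _ _ _ _ g]
  simp [hg']

lemma exists_unitary_diagonal_conj_of_charpoly_eq {n : Type*} [Fintype n] [DecidableEq n]
    {A B : Matrix n n ℂ} (hA : A.IsHermitian) (hB : B.IsHermitian)
    (h : A.charpoly = B.charpoly) :
    ∃ U ∈ unitaryGroup n ℂ, ∃ V ∈ unitaryGroup n ℂ, ∃ d : n → ℝ,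
      A = U * diagonal (fun i => (d i : ℂ)) * Uᴴ ∧ B = V * diagonal (fun i => (d i : ℂ)) * Vᴴ :=
  ⟨hA.eigenvectorUnitary, hA.eigenvectorUnitary.2, hB.eigenvectorUnitary,
    hB.eigenvectorUnitary.2, hA.eigenvalues, hA.spectral_theorem, by
      rw [(hA.eigenvalues_eq_eigenvalues_iff hB).2 h]
      exact hB.spectral_theorem⟩

lemma eq_fromBlocks_replicateCol_of_isHermitian {n : Type*} {x : Matrix (n ⊕ Fin 1) (n ⊕ Fin 1) ℂ}
    (hx : x.IsHermitian) :
    x = fromBlocks x.toBlocks₁₁ (replicateCol (Fin 1) fun i => x (.inl i) (.inr 0))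
      (replicateRow (Fin 1) (star fun i => x (.inl i) (.inr 0))) x.toBlocks₂₂ := by
  ext (i | i) (j | j)
  · rfl
  · simp [Subsingleton.elim j 0]
  · simpa [Subsingleton.elim i 0] using (hx.apply (.inr 0) (.inl j)).symm
  · rfl

/-- Two Hermitian matrices with the same characteristic polynomial, whose upper-left blocks of
corank one also have the same characteristic polynomial, are conjugate by a unitary acting on
the upper-left block only. -/
lemma exists_unitary_fromBlocks_conj_eq {n : Type*} [Fintype n] [DecidableEq n]
    {x y : Matrix (n ⊕ Fin 1) (n ⊕ Fin 1) ℂ} (hx : x.IsHermitian) (hy : y.IsHermitian)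
    (h : x.charpoly = y.charpoly) (h₁₁ : x.toBlocks₁₁.charpoly = y.toBlocks₁₁.charpoly) :
    ∃ g ∈ unitaryGroup n ℂ, fromBlocks g 0 0 1 * x * (fromBlocks g 0 0 1)ᴴ = y := by
  obtain ⟨U, hU, V, hV, d, hA, hB⟩ := exists_unitary_diagonal_conj_of_charpoly_eq
    (A := x.toBlocks₁₁) (B := y.toBlocks₁₁) (hx.submatrix Sum.inl) (hy.submatrix Sum.inl) h₁₁
  have hU₁ : Uᴴ * U = 1 := mem_unitaryGroup_iff'.1 hU
  have hU₂ : U * Uᴴ = 1 := mem_unitaryGroup_iff.1 hU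
  have hV₂ : V * Vᴴ = 1 := mem_unitaryGroup_iff.1 hV
  set v : n → ℂ := Uᴴ *ᵥ fun i => x (.inl i) (.inr 0) with hv
  set w : n → ℂ := Vᴴ *ᵥ fun i => y (.inl i) (.inr 0) with hw
  have hUv : (fun i => x (.inl i) (.inr 0)) = U *ᵥ v := by
    rw [hv, mulVec_mulVec, hU₂, one_mulVec]
  have hVw : (fun i => y (.inl i) (.inr 0)) = V *ᵥ w := by
    rw [hw, mulVec_mulVec, hV₂, one_mulVec]
  have hx' := eq_fromBlocks_replicateCol_of_isHermitian hx
  have hy' := eq_fromBlocks_replicateCol_of_isHermitian hy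
  rw [hA, hUv] at hx'
  rw [hB, hVw] at hy'
  rw [hx', hy', charpoly_fromBlocks_conj hU, charpoly_fromBlocks_conj hV] at h
  obtain ⟨hc, hsum⟩ := sum_filter_eq_of_charpoly_fromBlocks_diagonal_eq _ _ _ _ _ _ _ h
  obtain ⟨G, hG, hGd, hGv⟩ := exists_unitary_commute_mulVec_eq d v w fun μ => by
    simpa using hsum μ
  have hG₂ : G * Gᴴ = 1 := mem_unitaryGroup_iff.1 hG
  refine ⟨V * G * Uᴴ, mul_mem (mul_mem hV hG) (Unitary.star_mem hU), ?_⟩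
  rw [hx', hy', fromBlocks_conj, hc]
  have hvec : (V * G * Uᴴ) *ᵥ U *ᵥ v = V *ᵥ w := by
    rw [mulVec_mulVec, mul_assoc, hU₁, mul_one, ← mulVec_mulVec, hGv]
  rw [hvec]
  congr 1
  set D := diagonal fun i => (d i : ℂ)
  calc V * G * Uᴴ * (U * D * Uᴴ) * (V * G * Uᴴ)ᴴ
      = V * G * (Uᴴ * U) * D * (Uᴴ * U) * Gᴴ * Vᴴ := by
        simp only [conjTranspose_mul, conjTranspose_conjTranspose, mul_assoc]
    _ = V * (G * D) * Gᴴ * Vᴴ := by simp only [hU₁, mul_one, mul_assoc]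
    _ = V * D * (G * Gᴴ) * Vᴴ := by rw [hGd.eq]; simp only [mul_assoc]
    _ = V * D * Vᴴ := by rw [hG₂, mul_one]

lemma unitaryEmbed_eq_reindex (k : ℕ) (g : Matrix (Fin k) (Fin k) ℂ) :
    unitaryEmbed k g = reindex finSumFinEquiv finSumFinEquiv
      (fromBlocks g 0 0 (1 : Matrix (Fin 1) (Fin 1) ℂ)) := by
  rw [← Equiv.symm_apply_eq]
  ext (i | i) (j | j)
  · simp [unitaryEmbed]
  · simp [unitaryEmbed]
  · simp [unitaryEmbed]
  · simp [unitaryEmbed, Subsingleton.elim i j]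

/-- Let `a₁ ≥ b₁ ≥ a₂ ≥ ⋯ ≥ a_k ≥ b_k ≥ a_{k+1}` (1-based).  If `x` and
`y` are `(k+1) × (k+1)` Hermitian matrices with characteristic polynomial
`∏_{i=1}^{k+1}(X − aᵢ)` whose `k × k` leading principal submatrices both have characteristic
polynomial `∏_{i=1}^{k}(X − bᵢ)`, then there is `g ∈ U(k)` with `ι(g) x ι(g)* = y`:
the embedded `U(k)` acts transitively on `A_{k+1}(a, b)`. -/
theorem statement11 (k : ℕ) (hk : 1 ≤ k) (a b : ℕ → ℝ)
    (hab : ∀ i, 1 ≤ i → i ≤ k → b i ≤ a i ∧ a (i + 1) ≤ b i)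
    (x y : Matrix (Fin (k + 1)) (Fin (k + 1)) ℂ)
    (hx : x.IsHermitian) (hy : y.IsHermitian)
    (hxa : x.charpoly = ∏ i ∈ Finset.Icc 1 (k + 1), (X - C (a i : ℂ)))
    (hya : y.charpoly = ∏ i ∈ Finset.Icc 1 (k + 1), (X - C (a i : ℂ)))
    (hxb : (x.submatrix Fin.castSucc Fin.castSucc).charpoly
        = ∏ i ∈ Finset.Icc 1 k, (X - C (b i : ℂ)))
    (hyb : (y.submatrix Fin.castSucc Fin.castSucc).charpoly
        = ∏ i ∈ Finset.Icc 1 k, (X - C (b i : ℂ))) :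
    ∃ g ∈ Matrix.unitaryGroup (Fin k) ℂ,
      unitaryEmbed k g * x * (unitaryEmbed k g)ᴴ = y := by
  obtain ⟨g, hg, hgx⟩ := exists_unitary_fromBlocks_conj_eq
    (x := x.submatrix finSumFinEquiv finSumFinEquiv)
    (y := y.submatrix finSumFinEquiv finSumFinEquiv) (hx.submatrix _) (hy.submatrix _)
    ((charpoly_reindex finSumFinEquiv.symm x).trans <| (hxa.trans hya.symm).trans
      (charpoly_reindex finSumFinEquiv.symm y).symm) (hxb.trans hyb.symm)
  refine ⟨g, hg, ?_⟩
  rw [unitaryEmbed_eq_reindex]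
  apply (reindex finSumFinEquiv finSumFinEquiv).symm.injective
  simp only [reindex_symm, reindex_apply, Equiv.symm_symm, conjTranspose_submatrix]
  rw [← hgx]
  simp [← submatrix_mul_equiv _ _ _ finSumFinEquiv]
end
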